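/- arXiv:2511.09395 — 2 statements merged into one kernel-verified Lean document; each statement's English description precedes it below -/
import Mathlib

section
/- The Vidinli algebra V_{2n+1} is simple: if I ⊆ ℝ^{2n+1} is a linear subspace such that a ∗ x ∈ I and x ∗ a ∈ I for all x ∈ I and all a ∈ ℝ^{2n+1} (a two-sided ideal), then I = {0} or I = ℝ^{2n+1}. -/
noncomputable section

/-- Standard dot product on `ℝ^m`. -/
def dot {m : ℕ} (a b : Fin m → ℝ) : ℝ := ∑ i, a i * b i

/-- The distinguished unit vector `e₁` of the Vidinli algebra (index `0`). -/
def e1 (n : ℕ) : Fin (2*n+1) → ℝ := fun i => if i.val = 0 then 1 else 0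

/-- The standard symplectic form `ω` on `ℝ^{2n+1}` (vanishing on `e₁`):
`ω(a,b) = Σ_{k=1}^n (a_{2k} b_{2k+1} − a_{2k+1} b_{2k})` in the paper's 1-based indexing. -/
def omg (n : ℕ) (a b : Fin (2*n+1) → ℝ) : ℝ :=
  ∑ k : Fin n,
    (a ⟨2*k.val+1, by have := k.isLt; omega⟩ * b ⟨2*k.val+2, by have := k.isLt; omega⟩
   - a ⟨2*k.val+2, by have := k.isLt; omega⟩ * b ⟨2*k.val+1, by have := k.isLt; omega⟩)

/-- The Vidinli multiplication on `ℝ^{2n+1}`. -/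
def vprod (n : ℕ) (a b : Fin (2*n+1) → ℝ) : Fin (2*n+1) → ℝ :=
  dot a (e1 n) • b + dot b (e1 n) • a - dot a b • e1 n + omg n a b • e1 n

theorem dot_e1 (n : ℕ) (a : Fin (2*n+1) → ℝ) : dot a (e1 n) = a 0 := by
  simp [dot, e1]

theorem dot_self_eq_zero {m : ℕ} {a : Fin m → ℝ} : dot a a = 0 ↔ a = 0 :=
  dotProduct_self_eq_zero

theorem omg_self (n : ℕ) (a : Fin (2*n+1) → ℝ) : omg n a a = 0 := by
  simp [omg, mul_comm]

theorem omg_e1_right (n : ℕ) (a : Fin (2*n+1) → ℝ) : omg n a (e1 n) = 0 := by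
  simp [omg, e1]

theorem vprod_e1 (n : ℕ) (a : Fin (2*n+1) → ℝ) : vprod n a (e1 n) = a := by
  have h : e1 n 0 = 1 := by simp [e1]
  simp [vprod, dot_e1, omg_e1_right, h]

theorem vprod_self (n : ℕ) (a : Fin (2*n+1) → ℝ) :
    vprod n a a = (2 * a 0) • a - dot a a • e1 n := by
  rw [vprod, dot_e1, omg_self]
  module

/-- The Vidinli algebra `V_{2n+1}` is simple: every two-sided ideal
is `⊥` or `⊤`. -/
theorem vidinli_simple (n : ℕ) (hn : 1 ≤ n)
    (I : Submodule ℝ (Fin (2*n+1) → ℝ))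
    (hI : ∀ x ∈ I, ∀ a : Fin (2*n+1) → ℝ, vprod n a x ∈ I ∧ vprod n x a ∈ I) :
    I = ⊥ ∨ I = ⊤ := by
  refine or_iff_not_imp_left.mpr fun hbot => ?_
  obtain ⟨x, hx, hx0⟩ := I.ne_bot_iff.mp hbot
  have hsmul : dot x x • e1 n ∈ I := by
    have h := I.sub_mem (I.smul_mem (2 * x 0) hx) (hI x hx x).1
    rwa [vprod_self, sub_sub_cancel] at h
  have he : e1 n ∈ I := (I.smul_mem_iff (mt dot_self_eq_zero.mp hx0)).mp hsmul
  exact I.eq_top_iff'.mpr fun a => vprod_e1 n a ▸ (hI (e1 n) he a).1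
end
end

section
/- The commutator of the Vidinli multiplication satisfies [a, b] := a ∗ b − b ∗ a = 2 ω(a,b) e₁ for all a, b ∈ ℝ^{2n+1}. This bracket is bilinear, skew-symmetric, satisfies the Jacobi identity, and is 2-step nilpotent: [x, [y, z]] = 0 for all x, y, z. Moreover its center {x : [x, y] = 0 for all y} equals the line ℝe₁. (Hence (ℝ^{2n+1}, [·,·]) is a 2-step nilpotent Lie algebra, isomorphic to the (2n+1)-dimensional Heisenberg Lie algebra.) -/
noncomputable section

/-- The commutator bracket of the Vidinli multiplication. -/
def vbr (n : ℕ) (a b : Fin (2*n+1) → ℝ) : Fin (2*n+1) → ℝ :=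
  vprod n a b - vprod n b a

theorem dot_comm {m : ℕ} (a b : Fin m → ℝ) : dot a b = dot b a :=
  Finset.sum_congr rfl fun _ _ => mul_comm _ _

theorem omg_swap (n : ℕ) (a b : Fin (2*n+1) → ℝ) : omg n b a = - omg n a b := by
  simp only [omg, ← Finset.sum_neg_distrib]
  exact Finset.sum_congr rfl fun _ _ => by ring

theorem omg_smul_add_left (n : ℕ) (c : ℝ) (a a' b : Fin (2*n+1) → ℝ) :
    omg n (c • a + a') b = c * omg n a b + omg n a' b := by
  simp only [omg, Finset.mul_sum, ← Finset.sum_add_distrib, Pi.add_apply, Pi.smul_apply,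
    smul_eq_mul]
  exact Finset.sum_congr rfl fun _ _ => by ring

theorem omg_smul_add_right (n : ℕ) (c : ℝ) (a b b' : Fin (2*n+1) → ℝ) :
    omg n a (c • b + b') = c * omg n a b + omg n a b' := by
  rw [omg_swap, omg_smul_add_left, omg_swap n a b, omg_swap n a b']
  ring

theorem omg_smul_e1_right (n : ℕ) (c : ℝ) (a : Fin (2*n+1) → ℝ) :
    omg n a (c • e1 n) = 0 := by
  simp [omg, e1]

theorem omg_single_even (n : ℕ) (x : Fin (2*n+1) → ℝ) (k : Fin n) :
    omg n x (Pi.single ⟨2*k.val+2, by have := k.isLt; omega⟩ 1) =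
      x ⟨2*k.val+1, by have := k.isLt; omega⟩ := by
  rw [omg, Finset.sum_eq_single k]
  · simp
  · intro j _ hj
    have hjk : j.val ≠ k.val := fun h => hj (Fin.ext h)
    have hodd : 2*j.val ≠ 2*k.val+1 := by omega
    simp [hjk, hodd]
  · simp

theorem omg_single_odd (n : ℕ) (x : Fin (2*n+1) → ℝ) (k : Fin n) :
    omg n x (Pi.single ⟨2*k.val+1, by have := k.isLt; omega⟩ 1) =
      - x ⟨2*k.val+2, by have := k.isLt; omega⟩ := by
  rw [omg, Finset.sum_eq_single k]
  · simp
  · intro j _ hj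
    have hjk : j.val ≠ k.val := fun h => hj (Fin.ext h)
    have hodd : 2*j.val+2 ≠ 2*k.val+1 := by omega
    simp [hjk, hodd]
  · simp

/-- The radical of `ω` is contained in the line `ℝe₁`. -/
theorem eq_smul_e1_of_omg_eq_zero (n : ℕ) (x : Fin (2*n+1) → ℝ)
    (h : ∀ y, omg n x y = 0) : x = x 0 • e1 n := by
  funext ⟨i, hi⟩
  rcases Nat.eq_zero_or_pos i with rfl | hpos
  · simp [e1]
  suffices hx : x ⟨i, hi⟩ = 0 by simp [e1, hx, hpos.ne']
  rcases Nat.even_or_odd' i with ⟨j, rfl | rfl⟩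
  · obtain ⟨k, rfl⟩ : ∃ k, j = k + 1 := ⟨j - 1, by omega⟩
    simpa [mul_add] using (omg_single_odd n x ⟨k, by omega⟩).symm.trans (h _)
  · exact (omg_single_even n x ⟨j, by omega⟩).symm.trans (h _)

theorem vbr_eq (n : ℕ) (a b : Fin (2*n+1) → ℝ) : vbr n a b = (2 * omg n a b) • e1 n := by
  rw [vbr, vprod, vprod, omg_swap n a b, dot_comm b a]
  module

theorem e1_ne_zero (n : ℕ) : e1 n ≠ 0 := fun h => by
  simpa [e1] using congrFun h 0

theorem vbr_vbr (n : ℕ) (x y z : Fin (2*n+1) → ℝ) : vbr n x (vbr n y z) = 0 := by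
  rw [vbr_eq n y z, vbr_eq, omg_smul_e1_right, mul_zero, zero_smul]

/-- The commutator of the Vidinli multiplication equals `2ω(a,b)e₁`;
it is bilinear, skew-symmetric, satisfies the Jacobi identity, is 2-step nilpotent,
and its center is exactly the line `ℝe₁`. -/
theorem vidinli_commutator_heisenberg (n : ℕ) (hn : 1 ≤ n) :
    (∀ a b : Fin (2*n+1) → ℝ, vbr n a b = (2 * omg n a b) • e1 n) ∧
    (∀ (c : ℝ) (a a' b : Fin (2*n+1) → ℝ),
      vbr n (c • a + a') b = c • vbr n a b + vbr n a' b) ∧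
    (∀ (c : ℝ) (a b b' : Fin (2*n+1) → ℝ),
      vbr n a (c • b + b') = c • vbr n a b + vbr n a b') ∧
    (∀ a b : Fin (2*n+1) → ℝ, vbr n a b = - vbr n b a) ∧
    (∀ a b c : Fin (2*n+1) → ℝ,
      vbr n a (vbr n b c) + vbr n b (vbr n c a) + vbr n c (vbr n a b) = 0) ∧
    (∀ x y z : Fin (2*n+1) → ℝ, vbr n x (vbr n y z) = 0) ∧
    (∀ x : Fin (2*n+1) → ℝ,
      (∀ y : Fin (2*n+1) → ℝ, vbr n x y = 0) ↔ ∃ c : ℝ, x = c • e1 n) := by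
  refine ⟨vbr_eq n, fun c a a' b => ?_, fun c a b b' => ?_, fun a b => ?_, fun a b c => ?_,
    vbr_vbr n, fun x => ⟨fun h => ⟨x 0, ?_⟩, ?_⟩⟩
  · simp only [vbr_eq, omg_smul_add_left]
    module
  · simp only [vbr_eq, omg_smul_add_right]
    module
  · exact (neg_sub _ _).symm
  · simp only [vbr_vbr, add_zero]
  · refine eq_smul_e1_of_omg_eq_zero n x fun y => ?_
    have hy := h y
    rw [vbr_eq, smul_eq_zero_iff_left (e1_ne_zero n)] at hy
    linarith
  · rintro ⟨c, rfl⟩ y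
    rw [vbr_eq, omg_swap, omg_smul_e1_right, neg_zero, mul_zero, zero_smul]
end
end
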